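/- arXiv:2401.01009 — 4 statements merged into one kernel-verified Lean document; each statement's English description precedes it below -/
import Mathlib

section
/- Let ψ be an n-qubit state in which exactly k qubits are entangled (not separable). Then every circuit of single-qubit gates and CNOT gates mapping the ground state |0⟩ to ψ contains at least ⌈k/2⌉ CNOT gates; that is, γ(|0⟩, ψ) ≥ ⌈k/2⌉. -/
open scoped BigOperators

/-- Bit strings of length `n`, identified with indices of `ℂ^(2^n)`. -/
abbrev BString (n : ℕ) := Fin n → Bool

/-- An `n`-qubit (complex) amplitude vector. -/
abbrev QState (n : ℕ) := BString n → ℂ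

/-- `ψ` is an `n`-qubit state: a unit vector. -/
def IsQState {n : ℕ} (ψ : QState n) : Prop := ∑ x, Complex.normSq (ψ x) = 1

/-- Flip bit `t` of `y` whenever bit `c` of `y` is `1`. -/
def cnotFun {n : ℕ} (c t : Fin n) (y : BString n) : BString n :=
  Function.update y t (xor (y t) (y c))

/-- A gate: either a single-qubit gate on qubit `i` with 2×2 matrix `V`,
or a CNOT gate with control `c` and target `t`. -/
inductive Gate (n : ℕ) where
  | single (i : Fin n) (V : Matrix Bool Bool ℂ) : Gate n
  | cnot (c t : Fin n) : Gate n

/-- The unitary on `ℂ^(2^n)` implemented by a gate.  A single-qubit gate on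
qubit `i` is the Kronecker product `I ⊗ V ⊗ I` acting on qubit `i`; a CNOT
permutes basis vectors by flipping bit `t` when bit `c` is `1`. -/
def Gate.matrix {n : ℕ} : Gate n → Matrix (BString n) (BString n) ℂ
  | .single i V => fun x y => if ∀ j, j ≠ i → x j = y j then V (x i) (y i) else 0
  | .cnot c t => fun x y => if x = cnotFun c t y then 1 else 0

/-- Validity: `V ∈ U(2)` for single-qubit gates, `c ≠ t` for CNOTs. -/
def Gate.Valid {n : ℕ} : Gate n → Prop
  | .single _ V => V ∈ Matrix.unitaryGroup Bool ℂ
  | .cnot c t => c ≠ t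

def Gate.isCnot {n : ℕ} : Gate n → Bool
  | .single _ _ => false
  | .cnot _ _ => true

/-- A circuit: a finite sequence of gates (applied left to right). -/
abbrev Circuit (n : ℕ) := List (Gate n)

def Circuit.Valid {n : ℕ} (C : Circuit n) : Prop := ∀ g ∈ C, g.Valid

/-- The CNOT count of a circuit. -/
def Circuit.cnotCount {n : ℕ} (C : Circuit n) : ℕ := (C.filter Gate.isCnot).length

/-- Apply a circuit `C = [U₁, …, U_l]` to a state: result is `U_l ⋯ U₂ U₁ ψ`. -/
noncomputable def Circuit.apply {n : ℕ} (C : Circuit n) (ψ : QState n) : QState n :=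
  C.foldl (fun v g => g.matrix.mulVec v) ψ

/-- The composed product `U_l ⋯ U₂ U₁` of a circuit `C = [U₁, …, U_l]`. -/
noncomputable def Circuit.matrix {n : ℕ} (C : Circuit n) : Matrix (BString n) (BString n) ℂ :=
  ((C.map Gate.matrix).reverse).prod

/-- `γ(ψ,φ) ∈ ℕ∞`: the infimum over valid circuits mapping `ψ` to `φ`
of the CNOT count (`⊤` if no such circuit exists). -/
noncomputable def gamma {n : ℕ} (ψ φ : QState n) : ℕ∞ :=
  ⨅ (C : {C : Circuit n // C.Valid ∧ C.apply ψ = φ}), (C.1.cnotCount : ℕ∞)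

/-- `Δ(U) ∈ ℕ∞`: the CNOT cost of a unitary `U`, the infimum over valid circuits
whose composed product is `U` of the CNOT count. -/
noncomputable def Delta {n : ℕ} (U : Matrix (BString n) (BString n) ℂ) : ℕ∞ :=
  ⨅ (C : {C : Circuit n // C.Valid ∧ C.matrix = U}), (C.1.cnotCount : ℕ∞)

/-- The ground state `|0⟩`. -/
def groundState (n : ℕ) : QState n := fun x => if x = fun _ => false then 1 else 0

/-- Qubit `i` is separable in the `(n+1)`-qubit state `ψ` if
`ψ_x = φ_{x_i} · χ_{x∖i}` for some `φ ∈ ℂ²`, `χ ∈ ℂ^(2^n)`,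
where `x∖i` deletes bit `i` from `x`; otherwise qubit `i` is entangled. -/
def SeparableAt {n : ℕ} (ψ : QState (n + 1)) (i : Fin (n + 1)) : Prop :=
  ∃ (φ : Bool → ℂ) (χ : BString n → ℂ),
    ∀ x : BString (n + 1), ψ x = φ (x i) * χ (fun j => x (i.succAbove j))

theorem separableAt_iff_exists_update_invariant {n : ℕ} {ψ : QState (n + 1)} {i : Fin (n + 1)} :
    SeparableAt ψ i ↔ ∃ (φ : Bool → ℂ) (χ : QState (n + 1)),
      (∀ x b, χ (Function.update x i b) = χ x) ∧ ∀ x, ψ x = φ (x i) * χ x := by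
  constructor
  · rintro ⟨φ, χ, h⟩
    exact ⟨φ, fun x => χ (fun j => x (i.succAbove j)), fun x b => by simp, h⟩
  · rintro ⟨φ, χ, hχ, h⟩
    refine ⟨φ, fun y => χ (i.insertNth false y), fun x => ?_⟩
    rw [h x, ← hχ x false]
    congr 2
    exact (Fin.insertNth_removeNth i false x).symm

theorem separableAt_groundState {n : ℕ} (i : Fin (n + 1)) :
    SeparableAt (groundState (n + 1)) i := by
  refine ⟨fun b => if b = false then 1 else 0, groundState n, fun x => ?_⟩
  simp only [groundState, funext_iff, Fin.forall_iff_succAbove i]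
  split_ifs <;> simp_all

theorem cnotFun_involutive {n : ℕ} {c t : Fin n} (h : c ≠ t) :
    Function.Involutive (cnotFun c t) := by
  intro x
  ext j
  by_cases hj : j = t
  · subst hj
    simp [cnotFun, h]
  · simp [cnotFun, hj]

theorem cnotFun_update {n : ℕ} {c t j : Fin n} (hc : j ≠ c) (ht : j ≠ t) (x : BString n)
    (b : Bool) :
    cnotFun c t (Function.update x j b) = Function.update (cnotFun c t x) j b := by
  simp only [cnotFun, Function.update_of_ne hc.symm, Function.update_of_ne ht.symm]
  exact Function.update_comm ht _ _ _

theorem cnot_mulVec {n : ℕ} {c t : Fin n} (h : c ≠ t) (ψ : QState n) (x : BString n) :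
    (Gate.cnot c t).matrix.mulVec ψ x = ψ (cnotFun c t x) := by
  have key : ∀ y, x = cnotFun c t y ↔ cnotFun c t x = y := fun y =>
    ⟨fun e => by rw [e, cnotFun_involutive h], fun e => by rw [← e, cnotFun_involutive h]⟩
  simp [Matrix.mulVec, dotProduct, Gate.matrix, key]

theorem single_mulVec {n : ℕ} (i : Fin n) (V : Matrix Bool Bool ℂ) (ψ : QState n)
    (x : BString n) :
    (Gate.single i V).matrix.mulVec ψ x = ∑ b, V (x i) b * ψ (Function.update x i b) := by
  simp only [Matrix.mulVec, dotProduct, Gate.matrix, ite_mul, zero_mul]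
  rw [← Finset.sum_filter]
  symm
  refine Finset.sum_bij (fun b _ => Function.update x i b) ?_ ?_ ?_ ?_
  · intro b _
    simp +contextual
  · intro b _ b' _ e
    simpa using congrFun e i
  · intro y hy
    refine ⟨y i, Finset.mem_univ _, ?_⟩
    ext j
    by_cases hj : j = i
    · subst hj
      simp
    · simp [hj, (Finset.mem_filter.mp hy).2 j hj]
  · intro b _
    simp

theorem SeparableAt.single {n : ℕ} {ψ : QState (n + 1)} {j : Fin (n + 1)}
    (h : SeparableAt ψ j) (i : Fin (n + 1)) (V : Matrix Bool Bool ℂ) :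
    SeparableAt ((Gate.single i V).matrix.mulVec ψ) j := by
  rw [separableAt_iff_exists_update_invariant] at h ⊢
  obtain ⟨φ, χ, hχ, hψ⟩ := h
  by_cases hij : i = j
  · subst hij
    refine ⟨fun a => ∑ b, V a b * φ b, χ, hχ, fun x => ?_⟩
    simp [single_mulVec, hψ, hχ, add_mul, mul_assoc]
  · refine ⟨φ, fun x => ∑ b, V (x i) b * χ (Function.update x i b), fun x b => ?_, fun x => ?_⟩
    · simp only [Function.update_of_ne hij, Function.update_comm (Ne.symm hij), hχ]
    · simp only [single_mulVec, hψ, Function.update_of_ne (Ne.symm hij), Finset.mul_sum]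
      exact Finset.sum_congr rfl fun b _ => by ring

theorem SeparableAt.cnot {n : ℕ} {ψ : QState (n + 1)} {j c t : Fin (n + 1)}
    (h : SeparableAt ψ j) (hct : c ≠ t) (hc : j ≠ c) (ht : j ≠ t) :
    SeparableAt ((Gate.cnot c t).matrix.mulVec ψ) j := by
  rw [separableAt_iff_exists_update_invariant] at h ⊢
  obtain ⟨φ, χ, hχ, hψ⟩ := h
  refine ⟨φ, fun x => χ (cnotFun c t x), fun x b => ?_, fun x => ?_⟩
  · simp only [cnotFun_update hc ht, hχ]
  · rw [cnot_mulVec hct, hψ]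
    simp [cnotFun, ht]

theorem ncard_entangled_apply_le {n : ℕ} (C : Circuit (n + 1)) (hC : C.Valid)
    (ψ : QState (n + 1)) :
    {i | ¬ SeparableAt (C.apply ψ) i}.ncard ≤
      {i | ¬ SeparableAt ψ i}.ncard + 2 * C.cnotCount := by
  induction C generalizing ψ with
  | nil => simp [Circuit.apply]
  | cons g C ih =>
    have hg : g.Valid := hC g List.mem_cons_self
    have htail := ih (fun g' hg' => hC g' (List.mem_cons_of_mem g hg')) (g.matrix.mulVec ψ)
    change {i | ¬ SeparableAt (Circuit.apply C (g.matrix.mulVec ψ)) i}.ncard ≤ _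
    cases g with
    | single i V =>
      have hsub : {j | ¬ SeparableAt ((Gate.single i V).matrix.mulVec ψ) j} ⊆
          {j | ¬ SeparableAt ψ j} := fun j hj h => hj (h.single i V)
      have hcard := Set.ncard_le_ncard hsub (Set.toFinite _)
      have hcount : Circuit.cnotCount (Gate.single i V :: C) = Circuit.cnotCount C := rfl
      omega
    | cnot c t =>
      have hsub : {j | ¬ SeparableAt ((Gate.cnot c t).matrix.mulVec ψ) j} ⊆
          {j | ¬ SeparableAt ψ j} ∪ {c, t} := by
        intro j hj
        by_contra! hmem
        simp only [Set.mem_union, Set.mem_ofPred_eq, Set.mem_insert_iff, Set.mem_singleton_iff,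
          not_or, not_not] at hmem
        exact hj (hmem.1.cnot hg hmem.2.1 hmem.2.2)
      have hcard := Set.ncard_le_ncard hsub (Set.toFinite _)
      have hunion := Set.ncard_union_le {j | ¬ SeparableAt ψ j} {c, t}
      have hpair : ({c, t} : Set (Fin (n + 1))).ncard = 2 := Set.ncard_pair hg
      have hcount : Circuit.cnotCount (Gate.cnot c t :: C) = Circuit.cnotCount C + 1 := rfl
      omega

/-- if exactly `k` qubits are entangled in the `(n+1)`-qubit state
`ψ`, then every circuit of single-qubit and CNOT gates mapping `|0⟩` to `ψ`
contains at least `⌈k/2⌉` CNOT gates: `γ(|0⟩, ψ) ≥ ⌈k/2⌉`. -/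
theorem gamma_ge_half_entangled (n : ℕ) (ψ : QState (n + 1)) (hψ : IsQState ψ)
    (k : ℕ) (hk : {i : Fin (n + 1) | ¬ SeparableAt ψ i}.ncard = k) :
    (((k + 1) / 2 : ℕ) : ℕ∞) ≤ gamma (groundState (n + 1)) ψ := by
  refine le_iInf fun ⟨C, hC, hCψ⟩ => ?_
  have h := ncard_entangled_apply_le C hC (groundState (n + 1))
  simp only [hCψ, hk, separableAt_groundState, not_true_eq_false, Set.ofPred_false,
    Set.ncard_empty] at h
  exact_mod_cast (show (k + 1) / 2 ≤ C.cnotCount by omega)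
end

section
/- Gray-code decomposition of multi-controlled rotations: for every n ≥ 1 and every f : {0,1}^n → ℝ, the (n+1)-qubit unitary MCR_y(f) can be written as a product of 2^n single-qubit R_y gates acting on the target qubit and 2^n CNOT gates, each CNOT having its control among the n control qubits and its target the target qubit. In particular the CNOT cost of MCR_y(f) is at most 2^n. -/
open scoped BigOperators

/-- `R_y(θ)` as a complex 2×2 matrix: rows `(cos(θ/2), sin(θ/2))` and
`(−sin(θ/2), cos(θ/2))` (`false` = first row/column). -/
noncomputable def RyC (θ : ℝ) : Matrix Bool Bool ℂ :=
  fun b b' =>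
    match b, b' with
    | false, false => (Real.cos (θ / 2) : ℂ)
    | false, true  => (Real.sin (θ / 2) : ℂ)
    | true,  false => -(Real.sin (θ / 2) : ℂ)
    | true,  true  => (Real.cos (θ / 2) : ℂ)

/-- The multi-controlled rotation `MCR_y(f)` on `n+1` qubits: the first `n`
qubits are controls, the last qubit is the target, and it acts
block-diagonally by `|x⟩ ⊗ v ↦ |x⟩ ⊗ (R_y(f(x)) v)`. -/
noncomputable def MCRyMatrix {n : ℕ} (f : (Fin n → Bool) → ℝ) :
    Matrix (BString (n + 1)) (BString (n + 1)) ℂ :=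
  fun x y =>
    if ∀ j, j ≠ Fin.last n → x j = y j
    then RyC (f (fun i : Fin n => y i.castSucc)) (x (Fin.last n)) (y (Fin.last n))
    else 0

/-- The block-diagonal matrix applying `A y` to qubit `t`, conditionally on the other bits of `y`. -/
def blockMatrix {m : ℕ} (t : Fin m) (A : BString m → Matrix Bool Bool ℂ) :
    Matrix (BString m) (BString m) ℂ :=
  fun x y => if ∀ j, j ≠ t → x j = y j then A y (x t) (y t) else 0

/-- The matrix `X ^ b * R_y(θ)`. -/
noncomputable def flipRy (b : Bool) (θ : ℝ) : Matrix Bool Bool ℂ :=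
  fun p q => RyC θ (xor p b) q

/-- The value of bit `k - 1`, or `false` if there is no such bit. -/
def precedingBit {m : ℕ} : ℕ → BString m → Bool
  | 0, _ => false
  | k + 1, y => if h : k < m then y ⟨k, h⟩ else false

theorem forall_ne_eq_iff_eq_update {m : ℕ} (t : Fin m) (z y : BString m) :
    (∀ j, j ≠ t → z j = y j) ↔ z = Function.update y t (z t) := by
  rw [Function.eq_update_iff]
  simp

theorem blockMatrix_mul {m : ℕ} (t : Fin m) (A B : BString m → Matrix Bool Bool ℂ)
    (hA : DependsOn A {t}ᶜ) :
    blockMatrix t A * blockMatrix t B = blockMatrix t fun y => A y * B y := by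
  have hA' : ∀ y b, A (Function.update y t b) = A y := fun y b =>
    hA fun i hi => Function.update_of_ne hi _ _
  ext x y
  rw [Matrix.mul_apply]
  have hsum : ∑ z, blockMatrix t A x z * blockMatrix t B z y =
      ∑ b, blockMatrix t A x (Function.update y t b) *
        blockMatrix t B (Function.update y t b) y := by
    symm
    apply Finset.sum_of_injOn (fun b => Function.update y t b)
    · exact (Function.update_injective y t).injOn
    · simp
    · intro z _ hz
      have : ¬ ∀ j, j ≠ t → z j = y j := fun h =>
        hz ⟨z t, by simp, ((forall_ne_eq_iff_eq_update t z y).1 h).symm⟩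
      simp only [blockMatrix, if_neg this, mul_zero]
    · simp
  rw [hsum]
  have hupd : ∀ b, ∀ j, j ≠ t → Function.update y t b j = y j := fun b j hj =>
    Function.update_of_ne hj _ _
  have hiff : ∀ b, (∀ j, j ≠ t → x j = Function.update y t b j) ↔ ∀ j, j ≠ t → x j = y j :=
    fun b => forall₂_congr fun j hj => by rw [hupd b j hj]
  simp only [blockMatrix, hiff, if_pos (hupd _), hA', Function.update_self]
  split_ifs <;> simp [Matrix.mul_apply]

theorem flipRy_mul (b b' : Bool) (θ θ' : ℝ) :
    flipRy b θ * flipRy b' θ' = flipRy (xor b b') (θ' + bif b' then -θ else θ) := by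
  have hadd : (θ' + θ) / 2 = θ' / 2 + θ / 2 := by ring
  have hsub : (θ' + -θ) / 2 = θ' / 2 - θ / 2 := by ring
  ext p q
  cases b <;> cases b' <;> cases p <;> cases q <;>
    simp only [flipRy, RyC, Matrix.mul_apply, Fintype.sum_bool, Bool.xor_false, Bool.xor_true,
      Bool.not_false, Bool.not_true, cond_true, cond_false, hadd, hsub,
      Real.cos_add, Real.sin_add, Real.cos_sub, Real.sin_sub] <;>
    push_cast <;> ring

theorem RyC_mem_unitaryGroup (θ : ℝ) : RyC θ ∈ Matrix.unitaryGroup Bool ℂ := by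
  rw [Matrix.mem_unitaryGroup_iff]
  have h : (Real.cos (θ / 2) : ℂ) ^ 2 + (Real.sin (θ / 2) : ℂ) ^ 2 = 1 := by
    exact_mod_cast Real.cos_sq_add_sin_sq (θ / 2)
  ext p q
  cases p <;> cases q <;>
    simp only [RyC, Matrix.mul_apply, Fintype.sum_bool, Matrix.star_apply,
      RCLike.star_def, map_neg, Complex.conj_ofReal, Matrix.one_apply, if_true, reduceCtorEq,
      if_false] <;>
    first | linear_combination h | ring

theorem Circuit.matrix_append {m : ℕ} (C D : Circuit m) :
    Circuit.matrix (C ++ D) = Circuit.matrix D * Circuit.matrix C := by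
  simp [Circuit.matrix]

theorem Circuit.cnotCount_append {m : ℕ} (C D : Circuit m) :
    Circuit.cnotCount (C ++ D) = Circuit.cnotCount C + Circuit.cnotCount D := by
  simp [Circuit.cnotCount]

theorem Circuit.cnotCount_cnot {m : ℕ} (c t : Fin m) :
    Circuit.cnotCount [Gate.cnot c t] = 1 := rfl

theorem Circuit.matrix_singleton {m : ℕ} (g : Gate m) : Circuit.matrix [g] = g.matrix := by
  simp [Circuit.matrix]

theorem Circuit.matrix_single {m : ℕ} (t : Fin m) (θ : ℝ) :
    Circuit.matrix [Gate.single t (RyC θ)] = blockMatrix t fun _ => flipRy false θ := by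
  rw [Circuit.matrix_singleton]
  ext x y
  simp [Gate.matrix, blockMatrix, flipRy]

theorem Circuit.matrix_cnot {m : ℕ} (c t : Fin m) :
    Circuit.matrix [Gate.cnot c t] = blockMatrix t fun y => flipRy (y c) 0 := by
  rw [Circuit.matrix_singleton]
  ext x y
  simp only [Gate.matrix, blockMatrix, flipRy, cnotFun, Function.eq_update_iff]
  by_cases h : ∀ j, j ≠ t → x j = y j
  · rw [if_pos h]
    simp only [eq_true h, and_true]
    cases x t <;> cases y t <;> cases y c <;> simp [RyC]
  · rw [if_neg h, if_neg fun h' => h h'.2]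

/-- A circuit of `R_y` gates on the last qubit and CNOTs targeting it. -/
def Circuit.IsLastRotation {n : ℕ} (C : Circuit (n + 1)) : Prop :=
  ∀ g ∈ C,
    (∃ θ : ℝ, g = Gate.single (Fin.last n) (RyC θ)) ∨
    (∃ c : Fin (n + 1), c ≠ Fin.last n ∧ g = Gate.cnot c (Fin.last n))

theorem Circuit.IsLastRotation.valid {n : ℕ} {C : Circuit (n + 1)} (hC : C.IsLastRotation) :
    C.Valid := by
  intro g hg
  obtain ⟨θ, rfl⟩ | ⟨c, hc, rfl⟩ := hC g hg
  · exact RyC_mem_unitaryGroup θ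
  · exact hc

theorem Circuit.IsLastRotation.append {n : ℕ} {C D : Circuit (n + 1)}
    (hC : C.IsLastRotation) (hD : D.IsLastRotation) :
    Circuit.IsLastRotation (C ++ D) := fun g hg =>
  (List.mem_append.1 hg).elim (hC g) (hD g)

theorem dependsOn_precedingBit {m : ℕ} (k : ℕ) :
    DependsOn (precedingBit (m := m) k) {i | i.val < k} := by
  intro x y h
  cases k with
  | zero => rfl
  | succ k =>
    simp only [precedingBit]
    split_ifs with hk
    · exact h _ (by simp)
    · rfl

theorem Circuit.isLastRotation_cnot {n : ℕ} {c : Fin (n + 1)} (hc : c ≠ Fin.last n) :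
    Circuit.IsLastRotation [Gate.cnot c (Fin.last n)] := by
  intro g hg
  exact Or.inr ⟨c, hc, List.mem_singleton.1 hg⟩

/-- Gray-code circuit for rotation angles depending on the first `k` bits, up to a trailing CNOT
controlled on the last of these bits. -/
theorem exists_grayCode_circuit {n : ℕ} (k : ℕ) (hk : k ≤ n) (f : BString (n + 1) → ℝ)
    (hf : DependsOn f {i | i.val < k}) :
    ∃ C : Circuit (n + 1), C.IsLastRotation ∧
      C.matrix = blockMatrix (Fin.last n) (fun y => flipRy (precedingBit k y) (f y)) ∧
      (C.filter fun g => !g.isCnot).length = 2 ^ k ∧ C.cnotCount + 1 = 2 ^ k := by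
  induction k generalizing f with
  | zero =>
    refine ⟨[Gate.single (Fin.last n) (RyC (f fun _ => false))], ?_, ?_, ?_, ?_⟩
    · intro g hg
      exact Or.inl ⟨_, List.mem_singleton.1 hg⟩
    · rw [Circuit.matrix_single]
      congr 1
      funext y
      rw [hf (y := y) (by simp)]
      rfl
    · simp [Gate.isCnot]
    · simp [Circuit.cnotCount, Gate.isCnot]
  | succ k ih =>
    have hkn : k < n + 1 := by omega
    let c : Fin (n + 1) := ⟨k, hkn⟩
    have hc : c ≠ Fin.last n := by
      intro h
      have := congrArg Fin.val h
      simp [c] at this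
      omega
    let a : BString (n + 1) → ℝ := fun y =>
      (f (Function.update y c false) + f (Function.update y c true)) / 2
    let b : BString (n + 1) → ℝ := fun y =>
      (bif precedingBit k y then -1 else 1) *
        ((f (Function.update y c false) - f (Function.update y c true)) / 2)
    have hupd : ∀ v, DependsOn (fun y => f (Function.update y c v)) {i | i.val < k} := by
      intro v x y h
      refine hf fun i hi => ?_
      by_cases hic : i = c
      · subst hic; simp
      · rw [Function.update_of_ne hic, Function.update_of_ne hic]
        have : i.val ≠ k := fun h => hic (Fin.ext h)
        have : i.val < k + 1 := hi
        exact h i (show i.val < k by omega)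
    have ha : DependsOn a {i | i.val < k} := by
      intro x y h
      simp only [a, hupd false h, hupd true h]
    have hb : DependsOn b {i | i.val < k} := by
      intro x y h
      simp only [b, hupd false h, hupd true h, dependsOn_precedingBit k h]
    have hsub : {i : Fin (n + 1) | i.val < k} ⊆ {Fin.last n}ᶜ := by
      rintro i hi rfl
      simp at hi
      omega
    obtain ⟨A, hA, hAm, hAr, hAc⟩ := ih (by omega) a ha
    obtain ⟨B, hB, hBm, hBr, hBc⟩ := ih (by omega) b hb
    refine ⟨A ++ ([Gate.cnot c (Fin.last n)] ++ B),
      hA.append ((Circuit.isLastRotation_cnot hc).append hB), ?_, ?_, ?_⟩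
    · rw [Circuit.matrix_append, Circuit.matrix_append, Circuit.matrix_cnot, hAm, hBm, mul_assoc,
        blockMatrix_mul, blockMatrix_mul]
      · congr 1
        funext y
        rw [flipRy_mul, flipRy_mul]
        have hf' : f y = f (Function.update y c (y c)) := by rw [Function.update_eq_self]
        have hpre : precedingBit (k + 1) y = y c := by simp [precedingBit, hkn, c]
        rw [hf', hpre]
        congr 1
        · cases precedingBit k y <;> cases y c <;> rfl
        · simp only [a, b]
          cases precedingBit k y <;> cases y c <;> simp <;> ring
      · intro x y h
        simp only [dependsOn_precedingBit k fun i hi => h i (hsub hi),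
          hb fun i hi => h i (hsub hi)]
      · intro x y h
        simp only [h c hc]
    · simp only [List.filter_append, List.length_append, hAr, hBr, pow_succ]
      simp [Gate.isCnot]
      ring
    · rw [Circuit.cnotCount_append, Circuit.cnotCount_append, Circuit.cnotCount_cnot, pow_succ]
      omega

/-- Gray-code decomposition: for every `n ≥ 1` and every
rotation table `f`, the `(n+1)`-qubit unitary `MCR_y(f)` is a product of
`2^n` single-qubit `R_y` gates acting on the target qubit and `2^n` CNOT
gates, each CNOT having its control among the `n` control qubits and its
target the target qubit; in particular `Δ(MCR_y(f)) ≤ 2^n`. -/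
theorem mcry_gray_code_decomposition (n : ℕ) (hn : 1 ≤ n)
    (f : (Fin n → Bool) → ℝ) :
    (∃ C : Circuit (n + 1),
      C.Valid ∧
      C.matrix = MCRyMatrix f ∧
      (∀ g ∈ C,
        (∃ θ : ℝ, g = Gate.single (Fin.last n) (RyC θ)) ∨
        (∃ c : Fin (n + 1), c ≠ Fin.last n ∧ g = Gate.cnot c (Fin.last n))) ∧
      (C.filter (fun g => !g.isCnot)).length = 2 ^ n ∧
      C.cnotCount = 2 ^ n) ∧
    Delta (MCRyMatrix f) ≤ ((2 ^ n : ℕ) : ℕ∞) := by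
  have key : ∃ C : Circuit (n + 1), C.IsLastRotation ∧ C.matrix = MCRyMatrix f ∧
      (C.filter (fun g => !g.isCnot)).length = 2 ^ n ∧ C.cnotCount = 2 ^ n := by
    obtain ⟨k, rfl⟩ : ∃ k, n = k + 1 := ⟨n - 1, by omega⟩
    obtain ⟨C, hC, hCm, hCr, hCc⟩ := exists_grayCode_circuit (n := k + 1) (k + 1) le_rfl
      (fun y => f fun i => y i.castSucc)
      (fun x y h => congrArg f (funext fun i => h _ i.isLt))
    let c : Fin (k + 1 + 1) := (Fin.last k).castSucc
    have hc : c ≠ Fin.last (k + 1) := (Fin.castSucc_lt_last _).ne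
    refine ⟨C ++ [Gate.cnot c (Fin.last (k + 1))], hC.append (Circuit.isLastRotation_cnot hc),
      ?_, ?_, ?_⟩
    · rw [Circuit.matrix_append, Circuit.matrix_cnot, hCm, blockMatrix_mul]
      · have hpre : ∀ y : BString (k + 1 + 1), precedingBit (k + 1) y = y c := fun y => by
          simp only [precedingBit]
          rw [dif_pos (by omega)]
          rfl
        simp only [flipRy_mul, hpre, Bool.xor_self, neg_zero, Bool.cond_self, add_zero]
        ext x y
        simp [blockMatrix, MCRyMatrix, flipRy]
      · intro x y h
        simp only [h c hc]
    · simpa [List.filter_append, Gate.isCnot] using hCr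
    · rw [← hCc, Circuit.cnotCount_append, Circuit.cnotCount_cnot]
  obtain ⟨C, hC, hCm, hCr, hCc⟩ := key
  refine ⟨⟨C, hC.valid, hCm, hC, hCr, hCc⟩, ?_⟩
  rw [← hCc]
  exact iInf_le (fun C : {C : Circuit (n + 1) // C.Valid ∧ C.matrix = MCRyMatrix f} =>
    (C.1.cnotCount : ℕ∞)) ⟨C, hC.valid, hCm⟩
end

section
/- The 3-qubit state ψ = (1/2)(|000⟩ + |011⟩ + |101⟩ + |110⟩) can be prepared from the ground state by a circuit containing only 2 CNOT gates: γ(|0⟩, ψ) ≤ 2. (Concretely, there exist angles θ_1, θ_2 such that applying R_y(θ_1) on qubit 1, R_y(θ_2) on qubit 2, then CNOT with control qubit 1 and target qubit 3, then CNOT with control qubit 2 and target qubit 1, maps |000⟩ to ψ.) -/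
open scoped BigOperators

/-- The 3-qubit state `ψ = (1/2)(|000⟩ + |011⟩ + |101⟩ + |110⟩)`
(qubit `k` is coordinate `k−1`). -/
noncomputable def psiMotivating : QState 3 := fun x =>
  if (x 0 = false ∧ x 1 = false ∧ x 2 = false) ∨
     (x 0 = false ∧ x 1 = true  ∧ x 2 = true) ∨
     (x 0 = true  ∧ x 1 = false ∧ x 2 = true) ∨
     (x 0 = true  ∧ x 1 = true  ∧ x 2 = false)
  then (1 / 2 : ℂ) else 0

/-- A single-qubit gate mixes the two amplitudes that differ only in the `i`-th bit. -/
theorem Gate.single_mulVec_apply {n : ℕ} (i : Fin n) (V : Matrix Bool Bool ℂ) (ψ : QState n)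
    (x : BString n) :
    ((Gate.single i V).matrix.mulVec ψ) x = ∑ b, V (x i) b * ψ (Function.update x i b) := by
  classical
  simp only [Matrix.mulVec, dotProduct, Gate.matrix, ite_mul, zero_mul]
  rw [← Finset.sum_filter]
  refine (Finset.sum_bij (fun b _ => Function.update x i b) ?_ ?_ ?_ ?_).symm
  · intro b _
    simp only [Finset.mem_filter, Finset.mem_univ, true_and]
    intro j hj
    simp [hj]
  · intro a _ b _ h
    simpa using congrFun h i
  · intro y hy
    simp only [Finset.mem_filter, Finset.mem_univ, true_and] at hy
    refine ⟨y i, Finset.mem_univ _, ?_⟩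
    ext j
    by_cases hj : j = i
    · subst hj; simp
    · simp [hj, hy j hj]
  · intro b _
    simp

/-- A CNOT gate permutes amplitudes. -/
theorem Gate.cnot_mulVec_apply {n : ℕ} {c t : Fin n} (h : c ≠ t) (ψ : QState n)
    (x : BString n) :
    ((Gate.cnot c t).matrix.mulVec ψ) x = ψ (cnotFun c t x) := by
  simp [Matrix.mulVec, dotProduct, Gate.matrix, ← (cnotFun_involutive h).eq_iff]

/-- `R_y(-π/2)` sends `|0⟩` to the uniform superposition. -/
theorem RyC_neg_pi_div_two_apply_false (b : Bool) :
    RyC (-(Real.pi / 2)) b false = (√2 / 2 : ℝ) := by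
  have h : -(Real.pi / 2) / 2 = -(Real.pi / 4) := by ring
  cases b <;> simp [RyC, h]

theorem apply_groundState_eq_psiMotivating :
    Circuit.apply
      [Gate.single 0 (RyC (-(Real.pi / 2))), Gate.single 1 (RyC (-(Real.pi / 2))),
        Gate.cnot 0 2, Gate.cnot 1 0]
      (groundState 3) = psiMotivating := by
  have hsq : ((√2 / 2 : ℝ) : ℂ) * ((√2 / 2 : ℝ) : ℂ) = 1 / 2 := by
    rw [← Complex.ofReal_mul, div_mul_div_comm, Real.mul_self_sqrt zero_le_two]
    norm_num
  ext x
  simp only [Circuit.apply, List.foldl_cons, List.foldl_nil]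
  rw [Gate.cnot_mulVec_apply (by decide), Gate.cnot_mulVec_apply (by decide),
    Gate.single_mulVec_apply]
  simp only [Gate.single_mulVec_apply, Fintype.sum_bool]
  cases h0 : x 0 <;> cases h1 : x 1 <;> cases h2 : x 2 <;>
    simp [groundState, psiMotivating, cnotFun, funext_iff, Fin.forall_fin_succ,
      Function.update_apply, h0, h1, h2, RyC_neg_pi_div_two_apply_false] <;>
    simpa using hsq

/-- `ψ = (1/2)(|000⟩+|011⟩+|101⟩+|110⟩)` can be prepared from the
ground state with only 2 CNOT gates, `γ(|0⟩, ψ) ≤ 2`; concretely, there exist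
angles `θ₁, θ₂` such that applying `R_y(θ₁)` on qubit 1, `R_y(θ₂)` on qubit 2,
then CNOT(control 1, target 3), then CNOT(control 2, target 1) maps `|000⟩` to `ψ`. -/
theorem gamma_motivating_le_two :
    gamma (groundState 3) psiMotivating ≤ 2 ∧
    ∃ θ₁ θ₂ : ℝ,
      Circuit.apply
        [Gate.single 0 (RyC θ₁), Gate.single 1 (RyC θ₂),
         Gate.cnot 0 2, Gate.cnot 1 0]
        (groundState 3) = psiMotivating := by
  refine ⟨?_, -(Real.pi / 2), -(Real.pi / 2), apply_groundState_eq_psiMotivating⟩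
  refine iInf_le_of_le ⟨_, ?_, apply_groundState_eq_psiMotivating⟩ ?_
  · simp [Circuit.Valid, Gate.Valid, RyC_mem_unitaryGroup]
  · exact le_rfl
end

section
/- The minimum number of CNOT gates needed to prepare the 4-qubit GHZ state GHZ_4 = (1/√2)(|0000⟩ + |1111⟩) from the ground state is exactly 3: γ(|0⟩, GHZ_4) = 3. In particular the entangled-qubit lower bound ⌈4/2⌉ = 2 strictly underestimates this cost. -/
open scoped BigOperators

/-- The 4-qubit GHZ state `(1/√2)(|0000⟩ + |1111⟩)`. -/
noncomputable def ghz4 : QState 4 := fun x =>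
  if (x = fun _ => false) ∨ (x = fun _ => true)
  then ((1 : ℂ) / (Real.sqrt 2 : ℂ)) else 0

theorem cnotFun_cnotFun {n : ℕ} {c t : Fin n} (h : c ≠ t) (y : BString n) :
    cnotFun c t (cnotFun c t y) = y := by
  funext j
  by_cases hj : j = t
  · subst hj; simp [cnotFun, h]
  · simp [cnotFun, hj]

/-- The bit string that agrees with `x` where `s` is true and with `y` elsewhere. -/
def splice {n : ℕ} (s : Fin n → Bool) (x y : BString n) : BString n :=
  fun j => if s j then x j else y j

/-- The state `ψ` has Schmidt rank at most one across the bipartition given by `s`: all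
`2 × 2` minors of its coefficient matrix vanish. -/
def IsProductAcross {n : ℕ} (s : Fin n → Bool) (ψ : QState n) : Prop :=
  ∀ x y, ψ x * ψ y = ψ (splice s x y) * ψ (splice s y x)

/-- A gate is local for a bipartition if it is not a CNOT joining the two sides. -/
def Gate.IsLocal {n : ℕ} (s : Fin n → Bool) : Gate n → Prop
  | .single _ _ => True
  | .cnot c t => s c = s t

theorem splice_cnotFun {n : ℕ} {s : Fin n → Bool} {c t : Fin n} (h : s c = s t)
    (x y : BString n) :
    splice s (cnotFun c t x) (cnotFun c t y) = cnotFun c t (splice s x y) := by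
  funext j
  by_cases hj : j = t
  · subst hj; by_cases hs : s j <;> simp [splice, cnotFun, h, hs]
  · simp [splice, cnotFun, hj]

theorem splice_update {n : ℕ} (s : Fin n → Bool) (i : Fin n) (x y : BString n) (a b : Bool) :
    splice s (Function.update x i a) (Function.update y i b) =
      Function.update (splice s x y) i (if s i then a else b) := by
  funext j
  by_cases hj : j = i
  · subst hj; simp [splice]
  · simp [splice, hj]

theorem IsProductAcross.mulVec {n : ℕ} {s : Fin n → Bool} {ψ : QState n}
    (hψ : IsProductAcross s ψ) {g : Gate n} (hg : g.Valid) (hl : g.IsLocal s) :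
    IsProductAcross s (g.matrix.mulVec ψ) := by
  intro x y
  cases g with
  | cnot c t =>
    rw [cnot_mulVec hg, cnot_mulVec hg, cnot_mulVec hg, cnot_mulVec hg, hψ,
      splice_cnotFun hl, splice_cnotFun hl]
  | single i V =>
    simp only [single_mulVec, Finset.sum_mul_sum]
    have key (a b : Bool) := hψ (Function.update x i a) (Function.update y i b)
    simp only [splice_update] at key
    by_cases hs : s i
    · refine Finset.sum_congr rfl fun a _ => Finset.sum_congr rfl fun b _ => ?_
      have := key a b
      simp only [splice, hs, if_true] at this ⊢
      linear_combination V (x i) a * V (y i) b * this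
    · rw [Finset.sum_comm]
      refine Finset.sum_congr rfl fun a _ => Finset.sum_congr rfl fun b _ => ?_
      have := key b a
      simp only [splice, hs, Bool.false_eq_true, if_false] at this ⊢
      linear_combination V (x i) b * V (y i) a * this

theorem IsProductAcross.apply {n : ℕ} {s : Fin n → Bool} {C : Circuit n} (hC : C.Valid)
    (hl : ∀ g ∈ C, g.IsLocal s) {ψ : QState n} (hψ : IsProductAcross s ψ) :
    IsProductAcross s (C.apply ψ) := by
  induction C generalizing ψ with
  | nil => exact hψ
  | cons g C ih =>
    exact ih (fun g' h => hC g' (List.mem_cons_of_mem _ h))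
      (fun g' h => hl g' (List.mem_cons_of_mem _ h))
      (hψ.mulVec (hC g List.mem_cons_self) (hl g List.mem_cons_self))

theorem isProductAcross_groundState {n : ℕ} (s : Fin n → Bool) :
    IsProductAcross s (groundState n) := by
  intro x y
  simp only [groundState, ← ite_and, mul_ite, mul_one, mul_zero]
  refine if_congr ?_ rfl rfl
  simp only [funext_iff, splice, ← forall_and]
  refine forall_congr' fun j => ?_
  by_cases hs : s j <;> simp [hs, and_comm]

theorem not_isProductAcross_ghz4 {s : Fin 4 → Bool} {i j : Fin 4} (hij : s i ≠ s j) :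
    ¬ IsProductAcross s ghz4 := by
  intro h
  have h1 := h (fun _ => false) (fun _ => true)
  have h2 : ghz4 (splice s (fun _ => false) (fun _ => true)) = 0 := by
    rw [ghz4, if_neg]
    rintro (h | h) <;>
    · have hi := congrFun h i
      have hj := congrFun h j
      simp only [splice] at hi hj
      grind
  rw [h2, zero_mul] at h1
  simp [ghz4] at h1

theorem exists_bipartition_two (c t c' t' : Fin 4) :
    ∃ s : Fin 4 → Bool, (∃ i j, s i ≠ s j) ∧ s c = s t ∧ s c' = s t' := by
  revert c t c' t'
  decide +kernel

theorem exists_bipartition_of_cnotCount_le_two {C : Circuit 4} (h : C.cnotCount ≤ 2) :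
    ∃ s : Fin 4 → Bool, (∃ i j, s i ≠ s j) ∧ ∀ g ∈ C, g.IsLocal s := by
  have lift (s : Fin 4 → Bool) (hs : ∀ g ∈ C.filter Gate.isCnot, g.IsLocal s) :
      ∀ g ∈ C, g.IsLocal s := by
    intro g hg
    cases g with
    | single i V => trivial
    | cnot c t => exact hs _ (List.mem_filter.2 ⟨hg, rfl⟩)
  have two (g g' : Gate 4) :
      ∃ s : Fin 4 → Bool, (∃ i j, s i ≠ s j) ∧ g.IsLocal s ∧ g'.IsLocal s := by
    cases g with
    | single _ _ =>
      cases g' with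
      | single _ _ => simpa [Gate.IsLocal] using exists_bipartition_two 0 0 0 0
      | cnot c t => simpa [Gate.IsLocal] using exists_bipartition_two c t c t
    | cnot c t =>
      cases g' with
      | single _ _ => simpa [Gate.IsLocal] using exists_bipartition_two c t c t
      | cnot c' t' => exact exists_bipartition_two c t c' t'
  unfold Circuit.cnotCount at h
  match hL : C.filter Gate.isCnot, h with
  | [], _ =>
    obtain ⟨s, hs, -⟩ := exists_bipartition_two 0 0 0 0
    exact ⟨s, hs, lift s (by simp [hL])⟩
  | [g], _ =>
    obtain ⟨s, hs, hg, -⟩ := two g g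
    exact ⟨s, hs, lift s (by simpa [hL] using hg)⟩
  | [g, g'], _ =>
    obtain ⟨s, hs, hg, hg'⟩ := two g g'
    exact ⟨s, hs, lift s (by simpa [hL] using ⟨hg, hg'⟩)⟩
  | _ :: _ :: _ :: _, h => simp at h

theorem three_le_cnotCount_of_apply_eq_ghz4 {C : Circuit 4} (hC : C.Valid)
    (h : C.apply (groundState 4) = ghz4) : 3 ≤ C.cnotCount := by
  by_contra! hlt
  obtain ⟨s, ⟨i, j, hij⟩, hs⟩ := exists_bipartition_of_cnotCount_le_two (Nat.le_of_lt_succ hlt)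
  exact not_isProductAcross_ghz4 hij (h ▸ (isProductAcross_groundState s).apply hC hs)

/-- The Hadamard gate. -/
noncomputable def hadamard : Matrix Bool Bool ℂ :=
  fun a b => if a && b then -(1 / (Real.sqrt 2 : ℂ)) else 1 / (Real.sqrt 2 : ℂ)

theorem hadamard_mem_unitaryGroup : hadamard ∈ Matrix.unitaryGroup Bool ℂ := by
  have h2 : (Real.sqrt 2 : ℂ) * (Real.sqrt 2 : ℂ) = 2 := by
    rw [← Complex.ofReal_mul, Real.mul_self_sqrt (by norm_num)]; norm_num
  have h3 : (Real.sqrt 2 : ℂ)⁻¹ * (Real.sqrt 2 : ℂ)⁻¹ = 1 / 2 := by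
    rw [← mul_inv, h2]; norm_num
  rw [Matrix.mem_unitaryGroup_iff]
  ext a b
  cases a <;> cases b <;>
    (simp [Matrix.mul_apply, hadamard, Matrix.star_apply, h3]; try norm_num)

/-- A Hadamard gate on the first qubit followed by a CNOT from it to each other qubit. -/
noncomputable def ghz4Circuit : Circuit 4 :=
  [.single 0 hadamard, .cnot 0 1, .cnot 0 2, .cnot 0 3]

theorem ghz4Circuit_valid : ghz4Circuit.Valid := by
  simp [ghz4Circuit, Circuit.Valid, Gate.Valid, hadamard_mem_unitaryGroup]

theorem hadamard_mulVec_groundState (x : BString 4) :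
    (Gate.single 0 hadamard).matrix.mulVec (groundState 4) x =
      if Function.update x 0 false = fun _ => false then 1 / (Real.sqrt 2 : ℂ) else 0 := by
  have h : Function.update x 0 true ≠ fun _ => false := fun h => by simpa using congrFun h 0
  simp [single_mulVec, groundState, h, hadamard]

theorem ghz4Circuit_apply : ghz4Circuit.apply (groundState 4) = ghz4 := by
  have key : ∀ x : BString 4,
      Function.update (cnotFun 0 1 (cnotFun 0 2 (cnotFun 0 3 x))) 0 false = (fun _ => false) ↔
        x = (fun _ => false) ∨ x = fun _ => true := by
    decide +kernel
  funext x
  simp only [ghz4Circuit, Circuit.apply, List.foldl_cons, List.foldl_nil]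
  rw [cnot_mulVec (by decide), cnot_mulVec (by decide), cnot_mulVec (by decide),
    hadamard_mulVec_groundState]
  exact if_congr (key x) rfl rfl

/-- the minimum number of CNOT gates needed to prepare the
4-qubit GHZ state from the ground state is exactly 3: `γ(|0⟩, GHZ₄) = 3`. -/
theorem gamma_ghz4_eq_three : gamma (groundState 4) ghz4 = 3 := by
  refine le_antisymm ?_ (le_iInf fun C => ?_)
  · exact iInf_le_of_le ⟨ghz4Circuit, ghz4Circuit_valid, ghz4Circuit_apply⟩ le_rfl
  · exact_mod_cast three_le_cnotCount_of_apply_eq_ghz4 C.2.1 C.2.2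
end
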